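/- arXiv:0710.2305 — 2 statements merged into one kernel-verified Lean document; each statement's English description precedes it below -/
import Mathlib

section
/- Let n ≥ 3 and m ≥ 1 be integers with m ≤ C(n,2), and set s = ⌈1/(1 − 2m/n²)⌉. Then every simple graph G with n vertices and m edges satisfies k_3(G) ≥ C(s,3) · (1/s³) · (n − 2√(n² − 2sm/(s−1))) · (n + √(n² − 2sm/(s−1)))². -/
/-- `k_r(G)`: the number of `r`-cliques of a simple graph `G`. -/
noncomputable def kcliques {V : Type*} (G : SimpleGraph V) (r : ℕ) : ℕ :=
  {t : Finset V | G.IsNClique r t}.ncard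

/-- `s = ⌈1/(1 - 2m/n²)⌉`. -/
noncomputable def sOf (n m : ℕ) : ℕ := ⌈1 / (1 - 2 * (m : ℝ) / (n : ℝ) ^ 2)⌉₊

open Finset Filter Topology

lemma cubic_bound_of_turan_piece {A d E K α β : ℝ} (hA : 2 ≤ A) (hβ : 0 ≤ β) (hβα : β ≤ α)
    (hd : A * α + β = d) (hE : E = A * (A - 1) * α ^ 2 + 2 * A * α * β)
    (hK : A * (A - 1) * α ^ 2 * ((A - 2) * α + 3 * β) ≤ K)
    (h₁ : E ≤ A * d) (h₂ : E ≤ 2 * A * d - A * (A + 1)) :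
    3 * A * E - 3 * A * (A + 1) * d + A * (A + 1) * (A + 2) ≤ K := by
  subst hd hE
  set C := A + 1 - (A - 1) * α - 2 * β with hC
  have hA0 : 0 < A := by linarith
  have h₁' : (A - 1) * α ^ 2 + 2 * α * β ≤ A * α + β := by
    refine le_of_mul_le_mul_left ?_ hA0
    linarith
  have h₂' : 0 ≤ (α - 1) * C := by
    refine le_of_mul_le_mul_left ?_ hA0
    rw [hC]
    linarith
  have hα : 1 ≤ α := by
    by_contra! h
    have : 0 < C := by rw [hC]; nlinarith
    nlinarith
  have hαC : α - β ≤ α * C := by rw [hC]; nlinarith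
  have hC0 : 0 ≤ C := by
    by_contra! h
    nlinarith
  have hα2 : (A - 1) * (α - 1) ≤ 1 := by
    refine le_of_mul_le_mul_left (a := α) ?_ (by linarith)
    nlinarith
  have hα3 : α ≤ 2 := by nlinarith
  have h3 : (A - 1) * (α - 1) * (C + α - β) ≤ 3 * C := by
    have h4 : C + α - β ≤ 3 * C := by nlinarith
    have h5 : 0 ≤ C + α - β := by linarith
    nlinarith
  have h6 : 0 ≤ A * (α - 1) * (3 * C - (A - 1) * (α - 1) * (C + α - β)) :=
    mul_nonneg (mul_nonneg hA0.le (by linarith)) (by linarith)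
  refine le_trans ?_ hK
  rw [hC] at h6
  linarith

lemma cubic_bound_of_goodman {A d E K : ℝ} (hA : 2 ≤ A) (hd : 0 < d)
    (hd' : d ≤ A + 2) (h₀ : A * E ≤ (A - 1) * d ^ 2)
    (hK : 2 * E ^ 2 - E * d ^ 2 ≤ d * K)
    (h₁ : E ≤ A * d) (h₂ : E ≤ 2 * A * d - A * (A + 1)) :
    3 * A * E - 3 * A * (A + 1) * d + A * (A + 1) * (A + 2) ≤ K := by
  refine le_of_mul_le_mul_left (hK.trans' ?_) hd
  have key : ∀ M : ℝ, E ≤ M → 4 * M ≤ d * (d + 3 * A) →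
      0 ≤ 2 * M ^ 2 - M * d ^ 2 - d * (3 * A * M - 3 * A * (A + 1) * d + A * (A + 1) * (A + 2)) →
      d * (3 * A * E - 3 * A * (A + 1) * d + A * (A + 1) * (A + 2)) ≤ 2 * E ^ 2 - E * d ^ 2 := by
    intro M hM h4 h0
    have : 0 ≤ (M - E) * (d * (d + 3 * A) - 2 * (M + E)) :=
      mul_nonneg (by linarith) (by linarith)
    linarith
  rcases le_total d A with h | h
  · refine key _ h₂ ?_ ?_
    · nlinarith
    · have : 0 ≤ 2 * A * ((A - d) * (d - A - 1) ^ 2) :=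
        mul_nonneg (by linarith) (mul_nonneg (by linarith) (sq_nonneg _))
      linarith
  rcases le_total ((A - 1) * d) (A ^ 2) with h' | h'
  · have hA0 : 0 < A := by linarith
    obtain ⟨α, rfl⟩ : ∃ α, d = A * α := ⟨d / A, by field_simp⟩
    have hα : 1 ≤ α := by nlinarith
    have hα2 : (A - 1) * α ≤ A := by nlinarith
    refine key (A * (A - 1) * α ^ 2) ?_ ?_ ?_
    · nlinarith
    · have : 4 * (A - 1) * α ≤ A * α + 3 * A := by nlinarith
      nlinarith [mul_le_mul_of_nonneg_left this (by positivity : 0 ≤ A * α)]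
    · have h6 := cubic_bound_of_turan_piece (d := A * α) hA le_rfl (by linarith : 0 ≤ α) (by ring)
        rfl le_rfl (by nlinarith [mul_le_mul_of_nonneg_left hα2 (by positivity : 0 ≤ A * α)]) (by
          have : 0 ≤ A * (α - 1) * (A + 1 - (A - 1) * α) :=
            mul_nonneg (mul_nonneg hA0.le (by linarith)) (by linarith)
          linarith)
      have := mul_le_mul_of_nonneg_left h6 hd.le
      linarith
  · refine key _ h₁ (by nlinarith) ?_
    have h7 : A + 1 ≤ d := by
      by_contra! h8
      nlinarith
    have : 0 ≤ A * d * ((d - A - 1) * (A + 2 - d)) :=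
        mul_nonneg (mul_nonneg (by linarith) hd.le) (mul_nonneg (by linarith) (by linarith))
    linarith

section Weighted

variable {ι : Type*} [Fintype ι]

def edgeSum (w : ι → ι → ℝ) (x : ι → ℝ) : ℝ := ∑ i, ∑ j, w i j * x i * x j

def triSum (w : ι → ι → ℝ) (x : ι → ℝ) : ℝ :=
  ∑ i, ∑ j, ∑ k, w i j * w i k * w j k * x i * x j * x k

def link (w : ι → ι → ℝ) (x : ι → ℝ) (v : ι) : ι → ℝ := fun j => w v j * x j

def wdeg (w : ι → ι → ℝ) (x : ι → ℝ) (v : ι) : ℝ := ∑ j, w v j * x j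

def codeg (w : ι → ι → ℝ) (x : ι → ℝ) (u v : ι) : ℝ := ∑ k, w u k * w v k * x k

structure IsWeight (w : ι → ι → ℝ) : Prop where
  symm : ∀ i j, w i j = w j i
  nonneg : ∀ i j, 0 ≤ w i j
  le_one : ∀ i j, w i j ≤ 1

variable {w : ι → ι → ℝ} {x : ι → ℝ}

lemma edgeSum_nonneg (hw : IsWeight w) (hx : ∀ i, 0 ≤ x i) : 0 ≤ edgeSum w x :=
  sum_nonneg fun i _ => sum_nonneg fun j _ =>
    mul_nonneg (mul_nonneg (hw.nonneg i j) (hx i)) (hx j)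

lemma triSum_nonneg (hw : IsWeight w) (hx : ∀ i, 0 ≤ x i) : 0 ≤ triSum w x :=
  sum_nonneg fun i _ => sum_nonneg fun j _ => sum_nonneg fun k _ =>
    mul_nonneg (mul_nonneg (mul_nonneg (mul_nonneg (mul_nonneg (hw.nonneg i j) (hw.nonneg i k))
      (hw.nonneg j k)) (hx i)) (hx j)) (hx k)

omit [Fintype ι] in
lemma link_nonneg (hw : IsWeight w) (hx : ∀ i, 0 ≤ x i) (v i : ι) : 0 ≤ link w x v i :=
  mul_nonneg (hw.nonneg v i) (hx i)

lemma sum_link (v : ι) : ∑ i, link w x v i = wdeg w x v := rfl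

lemma edgeSum_smul (c : ℝ) : edgeSum w (fun i => c * x i) = c ^ 2 * edgeSum w x := by
  simp only [edgeSum, mul_sum]
  exact sum_congr rfl fun i _ => sum_congr rfl fun j _ => by ring

lemma triSum_smul (c : ℝ) : triSum w (fun i => c * x i) = c ^ 3 * triSum w x := by
  simp only [triSum, mul_sum]
  exact sum_congr rfl fun i _ => sum_congr rfl fun j _ => sum_congr rfl fun k _ => by ring

lemma sum_mul_wdeg : ∑ i, x i * wdeg w x i = edgeSum w x := by
  simp only [edgeSum, wdeg, mul_sum]
  exact sum_congr rfl fun i _ => sum_congr rfl fun j _ => by ring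

lemma sum_mul_edgeSum_link : ∑ i, x i * edgeSum w (link w x i) = triSum w x := by
  simp only [edgeSum, triSum, link, mul_sum]
  exact sum_congr rfl fun i _ => sum_congr rfl fun j _ => sum_congr rfl fun k _ => by ring

lemma edgeSum_link_eq (v : ι) :
    edgeSum w (link w x v) = ∑ u, w v u * codeg w x v u * x u := by
  simp only [edgeSum, link, codeg, mul_sum, sum_mul]
  exact sum_congr rfl fun i _ => sum_congr rfl fun j _ => by ring

lemma triSum_eq_codeg : triSum w x = ∑ i, ∑ j, w i j * codeg w x i j * x i * x j := by
  simp only [triSum, codeg, mul_sum, sum_mul]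
  exact sum_congr rfl fun i _ => sum_congr rfl fun j _ => sum_congr rfl fun k _ => by ring

lemma edge_wdeg_left :
    ∑ i, ∑ j, w i j * x i * x j * wdeg w x i = ∑ i, x i * wdeg w x i ^ 2 := by
  refine sum_congr rfl fun i _ => ?_
  rw [sq, ← mul_assoc]
  nth_rewrite 3 [wdeg]
  rw [mul_sum]
  exact sum_congr rfl fun j _ => by ring

lemma edge_wdeg_right (hw : IsWeight w) :
    ∑ i, ∑ j, w i j * x i * x j * wdeg w x j = ∑ i, x i * wdeg w x i ^ 2 := by
  rw [sum_comm, ← edge_wdeg_left]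
  exact sum_congr rfl fun i _ => sum_congr rfl fun j _ => by rw [hw.symm j i]; ring

lemma sum_co_nonadjacent (i j : ι) :
    ∑ k, (1 - w i k) * (1 - w j k) * x k
      = ∑ k, x k - wdeg w x i - wdeg w x j + codeg w x i j := by
  simp only [wdeg, codeg, ← sum_sub_distrib, ← sum_add_distrib]
  exact sum_congr rfl fun k _ => by ring

/-- The Moon–Moser–Goodman inequality. -/
lemma goodman (hw : IsWeight w) (hx : ∀ i, 0 ≤ x i) :
    2 * edgeSum w x ^ 2 - edgeSum w x * (∑ i, x i) ^ 2 ≤ (∑ i, x i) * triSum w x := by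
  have h1 : 0 ≤ ∑ i, ∑ j, w i j * x i * x j * ∑ k, (1 - w i k) * (1 - w j k) * x k :=
    sum_nonneg fun i _ => sum_nonneg fun j _ =>
      mul_nonneg (mul_nonneg (mul_nonneg (hw.nonneg i j) (hx i)) (hx j)) <|
        sum_nonneg fun k _ => mul_nonneg (mul_nonneg (sub_nonneg.2 (hw.le_one i k))
          (sub_nonneg.2 (hw.le_one j k))) (hx k)
  have h2 : ∑ i, ∑ j, w i j * x i * x j * ∑ k, (1 - w i k) * (1 - w j k) * x k
      = edgeSum w x * (∑ i, x i) - 2 * ∑ i, x i * wdeg w x i ^ 2 + triSum w x := by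
    rw [two_mul]
    nth_rewrite 1 [← edge_wdeg_left]
    rw [← edge_wdeg_right hw, triSum_eq_codeg]
    simp only [edgeSum, sum_mul _ _ (∑ i, x i), ← sum_sub_distrib, ← sum_add_distrib,
      sum_co_nonadjacent]
    exact sum_congr rfl fun i _ => sum_congr rfl fun j _ => by ring
  have h3 : edgeSum w x ^ 2 ≤ (∑ i, x i) * ∑ i, x i * wdeg w x i ^ 2 := by
    rw [← sum_mul_wdeg]
    refine sum_sq_le_sum_mul_sum_of_sq_le_mul _ (fun i _ => hx i)
      (fun i _ => mul_nonneg (hx i) (sq_nonneg _)) fun i _ => le_of_eq (by ring)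
  have h4 : 0 ≤ ∑ i, x i := sum_nonneg fun i _ => hx i
  rw [h2] at h1
  nlinarith [mul_nonneg h4 h1]

lemma sum_codeg_mul_co_nonadjacent (hw : IsWeight w) (h1 : ∑ i, x i = 1) :
    ∑ i, ∑ j, w i j * (∑ k, (1 - w i k) * (1 - w j k) * x k) * codeg w x i j * x i * x j
      = triSum w x - 2 * ∑ i, x i * (wdeg w x i * edgeSum w (link w x i))
        + ∑ i, ∑ j, w i j * codeg w x i j ^ 2 * x i * x j := by
  have hl : ∑ i, ∑ j, w i j * codeg w x i j * x i * x j * wdeg w x i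
      = ∑ i, x i * (wdeg w x i * edgeSum w (link w x i)) := by
    simp only [edgeSum_link_eq, mul_sum]
    exact sum_congr rfl fun i _ => sum_congr rfl fun j _ => by ring
  have hr : ∑ i, ∑ j, w i j * codeg w x i j * x i * x j * wdeg w x j
      = ∑ i, x i * (wdeg w x i * edgeSum w (link w x i)) := by
    rw [sum_comm, ← hl]
    refine sum_congr rfl fun i _ => sum_congr rfl fun j _ => ?_
    have : codeg w x j i = codeg w x i j := sum_congr rfl fun k _ => by ring
    rw [hw.symm j i, this]
    ring
  rw [two_mul]
  nth_rewrite 1 [← hl]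
  rw [← hr, triSum_eq_codeg]
  simp only [← sum_sub_distrib, ← sum_add_distrib, sum_co_nonadjacent, h1]
  exact sum_congr rfl fun i _ => sum_congr rfl fun j _ => by ring

lemma sum_edge_mul_co_nonadjacent (hw : IsWeight w) (h1 : ∑ i, x i = 1) :
    ∑ i, ∑ j, w i j * (∑ k, (1 - w i k) * (1 - w j k) * x k) * x i * x j
      = edgeSum w x - 2 * ∑ i, x i * wdeg w x i ^ 2 + triSum w x := by
  rw [two_mul]
  nth_rewrite 1 [← edge_wdeg_left]
  rw [← edge_wdeg_right hw, triSum_eq_codeg]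
  simp only [edgeSum, ← sum_sub_distrib, ← sum_add_distrib, sum_co_nonadjacent, h1]
  exact sum_congr rfl fun i _ => sum_congr rfl fun j _ => by ring

lemma four_vertex_inequality (hw : IsWeight w) (hx : ∀ i, 0 ≤ x i) (h1 : ∑ i, x i = 1) :
    ∑ l, x l * triSum w (link w x l) ≤
      triSum w x - 3 * ∑ i, x i * (wdeg w x i * edgeSum w (link w x i))
        + 3 * ∑ i, ∑ j, w i j * codeg w x i j ^ 2 * x i * x j := by
  set T : ι → ι → ι → ℝ := fun i j k => w i j * w i k * w j k * x i * x j * x k with hT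
  have T12 : ∀ i j k, T i j k = T j i k := fun i j k => by
    simp only [hT, hw.symm i j]; ring
  have T23 : ∀ i j k, T i j k = T i k j := fun i j k => by
    simp only [hT, hw.symm j k]; ring
  have d1 : ∑ i, ∑ j, ∑ k, T i j k * wdeg w x i
      = ∑ i, x i * (wdeg w x i * edgeSum w (link w x i)) := by
    simp only [edgeSum, link, mul_sum, hT]
    exact sum_congr rfl fun i _ => sum_congr rfl fun j _ => sum_congr rfl fun k _ => by ring
  have d2 : ∑ i, ∑ j, ∑ k, T i j k * wdeg w x j
      = ∑ i, x i * (wdeg w x i * edgeSum w (link w x i)) := by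
    rw [sum_comm, ← d1]
    simp only [T12]
  have d3 : ∑ i, ∑ j, ∑ k, T i j k * wdeg w x k
      = ∑ i, x i * (wdeg w x i * edgeSum w (link w x i)) := by
    rw [← d2]
    refine sum_congr rfl fun i _ => ?_
    rw [sum_comm]
    exact sum_congr rfl fun j _ => sum_congr rfl fun k _ => by rw [T23]
  have c1 : ∑ i, ∑ j, ∑ k, T i j k * codeg w x i j
      = ∑ i, ∑ j, w i j * codeg w x i j ^ 2 * x i * x j := by
    refine sum_congr rfl fun i _ => sum_congr rfl fun j _ => ?_
    rw [sq]
    nth_rewrite 2 [codeg]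
    simp only [mul_sum, sum_mul, hT]
    exact sum_congr rfl fun k _ => by ring
  have c2 : ∑ i, ∑ j, ∑ k, T i j k * codeg w x i k
      = ∑ i, ∑ j, w i j * codeg w x i j ^ 2 * x i * x j := by
    rw [← c1]
    refine sum_congr rfl fun i _ => ?_
    rw [sum_comm]
    exact sum_congr rfl fun j _ => sum_congr rfl fun k _ => by rw [T23]
  have c3 : ∑ i, ∑ j, ∑ k, T i j k * codeg w x j k
      = ∑ i, ∑ j, w i j * codeg w x i j ^ 2 * x i * x j := by
    rw [← c2, sum_comm]
    exact sum_congr rfl fun j _ => sum_congr rfl fun k _ => sum_congr rfl fun k _ => by rw [T12]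
  have q : ∑ i, ∑ j, ∑ k, T i j k * ∑ l, w i l * w j l * w k l * x l
      = ∑ l, x l * triSum w (link w x l) := by
    simp only [triSum, link, mul_sum]
    symm
    rw [sum_comm]
    refine sum_congr rfl fun i _ => ?_
    rw [sum_comm]
    refine sum_congr rfl fun j _ => ?_
    rw [sum_comm]
    refine sum_congr rfl fun k _ => sum_congr rfl fun l _ => ?_
    rw [hw.symm l i, hw.symm l j, hw.symm l k]
    ring
  have key : 0 ≤ ∑ i, ∑ j, ∑ k, T i j k *
      ∑ l, (1 - w i l) * (1 - w j l) * (1 - w k l) * x l := by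
    refine sum_nonneg fun i _ => sum_nonneg fun j _ => sum_nonneg fun k _ => mul_nonneg ?_ <|
      sum_nonneg fun l _ => mul_nonneg (mul_nonneg (mul_nonneg (sub_nonneg.2 (hw.le_one i l))
        (sub_nonneg.2 (hw.le_one j l))) (sub_nonneg.2 (hw.le_one k l))) (hx l)
    exact mul_nonneg (mul_nonneg (mul_nonneg (mul_nonneg (mul_nonneg (hw.nonneg i j)
      (hw.nonneg i k)) (hw.nonneg j k)) (hx i)) (hx j)) (hx k)
  have expand : ∀ i j k, ∑ l, (1 - w i l) * (1 - w j l) * (1 - w k l) * x l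
      = ∑ l, x l - wdeg w x i - wdeg w x j - wdeg w x k + codeg w x i j + codeg w x i k
        + codeg w x j k - ∑ l, w i l * w j l * w k l * x l := by
    intro i j k
    simp only [wdeg, codeg, ← sum_sub_distrib, ← sum_add_distrib]
    exact sum_congr rfl fun k _ => by ring
  simp only [expand, h1] at key
  simp only [mul_add, mul_sub, sum_add_distrib, sum_sub_distrib, d1, d2, d3, c1, c2, c3,
    q, mul_one] at key
  have : ∑ i, ∑ j, ∑ k, T i j k = triSum w x := rfl
  linarith

/-- Upper bound for the number of weighted `K₄`'s at a critical point. -/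
lemma k4_upper_bound (hw : IsWeight w) (hx : ∀ i, 0 ≤ x i) (h1 : ∑ i, x i = 1) {κ : ℝ}
    (hN : ∑ i, ∑ j, w i j * (∑ k, (1 - w i k) * (1 - w j k) * x k) * codeg w x i j * x i * x j
      ≤ κ * ∑ i, ∑ j, w i j * (∑ k, (1 - w i k) * (1 - w j k) * x k) * x i * x j)
    (hV : ∀ v, 0 < x v →
      edgeSum w (link w x v) = 2 * κ * wdeg w x v - (2 * κ * edgeSum w x - triSum w x)) :
    ∑ v, x v * triSum w (link w x v) ≤ 3 * κ * (edgeSum w x + triSum w x) - 2 * triSum w x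
      + 3 * edgeSum w x * triSum w x - 6 * κ * edgeSum w x ^ 2 := by
  have h4 := four_vertex_inequality hw hx h1
  rw [sum_codeg_mul_co_nonadjacent hw h1, sum_edge_mul_co_nonadjacent hw h1] at hN
  have hdt : ∑ i, x i * (wdeg w x i * edgeSum w (link w x i))
      = 2 * κ * ∑ i, x i * wdeg w x i ^ 2
        - (2 * κ * edgeSum w x - triSum w x) * edgeSum w x := by
    have hE : (2 * κ * edgeSum w x - triSum w x) * edgeSum w x =
        ∑ i, (2 * κ * edgeSum w x - triSum w x) * (x i * wdeg w x i) := by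
      rw [← mul_sum, sum_mul_wdeg]
    rw [hE]
    simp only [mul_sum, ← sum_sub_distrib]
    refine sum_congr rfl fun i _ => ?_
    rcases (hx i).eq_or_lt with h | h
    · simp [← h]
    · rw [hV i h]; ring
  rw [hdt] at hN h4
  linarith

end Weighted

lemma deriv_nonneg_of_right_min {φ : ℝ → ℝ} {φ' : ℝ} (h : HasDerivAt φ φ' 0)
    (hmin : ∀ᶠ η in 𝓝[>] (0 : ℝ), φ 0 ≤ φ η) : 0 ≤ φ' := by
  have h1 := (hasDerivWithinAt_iff_tendsto_slope' (s := Set.Ioi (0 : ℝ)) (by simp)).1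
    h.hasDerivWithinAt
  refine ge_of_tendsto h1 ?_
  filter_upwards [hmin, self_mem_nhdsWithin] with η h2 h3
  rw [slope_def_field]
  exact div_nonneg (by linarith) (by simpa using le_of_lt h3)

lemma hasDerivAt_edgeSum_vertex {ι : Type*} [Fintype ι] {w : ι → ι → ℝ} {x : ι → ℝ}
    (hw : IsWeight w) (y : ι → ℝ) :
    HasDerivAt (fun η : ℝ => edgeSum w (fun i => x i + η * y i))
      (2 * ∑ i, y i * wdeg w x i) 0 := by
  have hl : ∀ i, HasDerivAt (fun η : ℝ => x i + η * y i) (y i) 0 := fun i => by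
    simpa using ((hasDerivAt_id (0 : ℝ)).mul_const (y i)).const_add (x i)
  have h : HasDerivAt (fun η : ℝ => edgeSum w (fun i => x i + η * y i))
      (∑ i, ∑ j, (w i j * y i * x j + w i j * x i * y j)) 0 := by
    refine HasDerivAt.fun_sum fun i _ => HasDerivAt.fun_sum fun j _ => ?_
    simpa using ((hl i).const_mul (w i j)).fun_mul (hl j)
  convert h using 1
  simp only [sum_add_distrib]
  rw [sum_comm (f := fun i j => w i j * x i * y j), two_mul]
  simp only [wdeg, mul_sum]
  refine congr_arg₂ _ ?_ ?_ <;> refine sum_congr rfl fun i _ => sum_congr rfl fun j _ => ?_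
  · ring
  · rw [hw.symm j i]; ring

lemma hasDerivAt_triSum_vertex {ι : Type*} [Fintype ι] {w : ι → ι → ℝ} {x : ι → ℝ}
    (hw : IsWeight w) (y : ι → ℝ) :
    HasDerivAt (fun η : ℝ => triSum w (fun i => x i + η * y i))
      (3 * ∑ i, y i * edgeSum w (link w x i)) 0 := by
  have hl : ∀ i, HasDerivAt (fun η : ℝ => x i + η * y i) (y i) 0 := fun i => by
    simpa using ((hasDerivAt_id (0 : ℝ)).mul_const (y i)).const_add (x i)
  have h : HasDerivAt (fun η : ℝ => triSum w (fun i => x i + η * y i))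
      (∑ i, ∑ j, ∑ k, ((w i j * w i k * w j k * y i * x j + w i j * w i k * w j k * x i * y j) * x k
        + w i j * w i k * w j k * x i * x j * y k)) 0 := by
    refine HasDerivAt.fun_sum fun i _ => HasDerivAt.fun_sum fun j _ =>
      HasDerivAt.fun_sum fun k _ => ?_
    simpa using (((hl i).const_mul (w i j * w i k * w j k)).fun_mul (hl j)).fun_mul (hl k)
  convert h using 1
  have e1 : ∑ i, y i * edgeSum w (link w x i)
      = ∑ i, ∑ j, ∑ k, w i j * w i k * w j k * y i * x j * x k := by
    simp only [edgeSum, link, mul_sum]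
    exact sum_congr rfl fun i _ => sum_congr rfl fun j _ => sum_congr rfl fun k _ => by ring
  have e2 : ∑ i, y i * edgeSum w (link w x i)
      = ∑ i, ∑ j, ∑ k, w i j * w i k * w j k * x i * y j * x k := by
    rw [e1, sum_comm]
    refine sum_congr rfl fun i _ => sum_congr rfl fun j _ => sum_congr rfl fun k _ => ?_
    rw [hw.symm j i]; ring
  have e3 : ∑ i, y i * edgeSum w (link w x i)
      = ∑ i, ∑ j, ∑ k, w i j * w i k * w j k * x i * x j * y k := by
    rw [e2]
    refine sum_congr rfl fun i _ => ?_
    rw [sum_comm]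
    refine sum_congr rfl fun j _ => sum_congr rfl fun k _ => ?_
    rw [hw.symm k j]; ring
  simp only [add_mul, sum_add_distrib]
  rw [← e1, ← e2, ← e3]
  ring

lemma hasDerivAt_edgeSum_weight {ι : Type*} [Fintype ι] {w : ι → ι → ℝ} {x : ι → ℝ}
    (h : ι → ι → ℝ) :
    HasDerivAt (fun η : ℝ => edgeSum (fun i j => w i j + η * h i j) x)
      (∑ i, ∑ j, h i j * x i * x j) 0 := by
  refine HasDerivAt.fun_sum fun i _ => HasDerivAt.fun_sum fun j _ => ?_
  simpa using ((((hasDerivAt_id (0 : ℝ)).mul_const (h i j)).const_add (w i j)).mul_const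
    (x i)).mul_const (x j)

lemma hasDerivAt_triSum_weight {ι : Type*} [Fintype ι] {w : ι → ι → ℝ} {x : ι → ℝ}
    (hw : IsWeight w) (h : ι → ι → ℝ) :
    HasDerivAt (fun η : ℝ => triSum (fun i j => w i j + η * h i j) x)
      (3 * ∑ i, ∑ j, h i j * codeg w x i j * x i * x j) 0 := by
  have hl : ∀ i j, HasDerivAt (fun η : ℝ => w i j + η * h i j) (h i j) 0 := fun i j => by
    simpa using ((hasDerivAt_id (0 : ℝ)).mul_const (h i j)).const_add (w i j)
  have h' : HasDerivAt (fun η : ℝ => triSum (fun i j => w i j + η * h i j) x)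
      (∑ i, ∑ j, ∑ k, ((h i j * w i k + w i j * h i k) * w j k
        + w i j * w i k * h j k) * x i * x j * x k) 0 := by
    refine HasDerivAt.fun_sum fun i _ => HasDerivAt.fun_sum fun j _ =>
      HasDerivAt.fun_sum fun k _ => ?_
    simpa using (((((hl i j).fun_mul (hl i k)).fun_mul (hl j k)).mul_const (x i)).mul_const
      (x j)).mul_const (x k)
  convert h' using 1
  have e1 : ∑ i, ∑ j, h i j * codeg w x i j * x i * x j
      = ∑ i, ∑ j, ∑ k, h i j * w i k * w j k * x i * x j * x k := by
    simp only [codeg, mul_sum, sum_mul]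
    exact sum_congr rfl fun i _ => sum_congr rfl fun j _ => sum_congr rfl fun k _ => by ring
  have e2 : ∑ i, ∑ j, h i j * codeg w x i j * x i * x j
      = ∑ i, ∑ j, ∑ k, w i j * h i k * w j k * x i * x j * x k := by
    rw [e1]
    refine sum_congr rfl fun i _ => ?_
    rw [sum_comm]
    refine sum_congr rfl fun j _ => sum_congr rfl fun k _ => ?_
    rw [hw.symm k j]; ring
  have e3 : ∑ i, ∑ j, h i j * codeg w x i j * x i * x j
      = ∑ i, ∑ j, ∑ k, w i j * w i k * h j k * x i * x j * x k := by
    rw [e2, sum_comm]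
    refine sum_congr rfl fun i _ => sum_congr rfl fun j _ => sum_congr rfl fun k _ => ?_
    rw [hw.symm j i]; ring
  simp only [add_mul, sum_add_distrib]
  rw [← e1, ← e2, ← e3]
  ring

noncomputable def rootOf (t e : ℝ) : ℝ := √(1 - (t + 1) * e / t)

noncomputable def triBound (t e : ℝ) : ℝ :=
  t * (t - 1) / (t + 1) ^ 2 * (1 - 2 * rootOf t e) * (1 + rootOf t e) ^ 2

lemma rootOf_sq {t e : ℝ} (ht : 0 < t) (h : (t + 1) * e ≤ t) :
    rootOf t e ^ 2 = 1 - (t + 1) * e / t := by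
  refine Real.sq_sqrt (sub_nonneg.2 ?_)
  rwa [div_le_one ht]

lemma rootOf_nonneg (t e : ℝ) : 0 ≤ rootOf t e := Real.sqrt_nonneg _

lemma hasDerivAt_triBound {t e : ℝ} (ht : 0 < t) (he : (t + 1) * e < t) :
    HasDerivAt (triBound t) (3 * ((t - 1) * ((1 + rootOf t e) / (t + 1)))) e := by
  have hpos : 0 < 1 - (t + 1) * e / t := by
    rw [sub_pos, div_lt_one ht]; exact he
  have hr : 0 < rootOf t e := Real.sqrt_pos.2 hpos
  have h1 : HasDerivAt (fun e => 1 - (t + 1) * e / t) (-((t + 1) / t)) e := by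
    simpa using (((hasDerivAt_id e).const_mul (t + 1)).div_const t).const_sub 1
  have h2 : HasDerivAt (rootOf t) (-((t + 1) / t) / (2 * rootOf t e)) e := h1.sqrt hpos.ne'
  have h3 := (((h2.const_mul 2).const_sub 1).const_mul (t * (t - 1) / (t + 1) ^ 2)).mul
    ((h2.const_add 1).pow 2)
  refine h3.congr_deriv ?_
  simp only [Pi.pow_apply]
  field_simp
  ring

lemma continuous_triBound (t : ℝ) : Continuous (triBound t) := by
  unfold triBound rootOf
  fun_prop

lemma rootOf_le {t e : ℝ} (ht : 0 < t) (h : t - 1 ≤ t * e) : t * rootOf t e ≤ 1 := by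
  rw [mul_comm, ← le_div_iff₀ ht]
  refine Real.sqrt_le_iff.2 ⟨by positivity, ?_⟩
  rw [sub_le_iff_le_add, ← sub_le_iff_le_add', le_div_iff₀ ht]
  have : (1 - (1 / t) ^ 2) * t = (t + 1) * ((t - 1) / t) := by field_simp; ring
  rw [this]
  refine mul_le_mul_of_nonneg_left ?_ (by linarith)
  rw [div_le_iff₀ ht]
  linarith

lemma triBound_eq {t e : ℝ} (ht : 0 < t) {a b : ℝ} (ha : a = (1 + rootOf t e) / (t + 1))
    (hb : b = (1 - t * rootOf t e) / (t + 1)) :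
    triBound t e = t * (t - 1) * a ^ 2 * ((t - 2) * a + 3 * b) := by
  subst ha hb
  unfold triBound
  field_simp
  ring

lemma edge_density_eq {t e : ℝ} (ht : 0 < t) (h : (t + 1) * e ≤ t) {a b : ℝ}
    (ha : a = (1 + rootOf t e) / (t + 1)) (hb : b = (1 - t * rootOf t e) / (t + 1)) :
    e = t * (t - 1) * a ^ 2 + 2 * t * a * b := by
  subst ha hb
  have h1 := rootOf_sq ht h
  have h2 : t * (t - 1) * ((1 + rootOf t e) / (t + 1)) ^ 2 + 2 * t * ((1 + rootOf t e) / (t + 1))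
      * ((1 - t * rootOf t e) / (t + 1)) = t / (t + 1) * (1 - rootOf t e ^ 2) := by
    field_simp
    ring
  rw [h2, h1]
  field_simp
  ring

/-- The triangle bound on the range of densities between the Turán densities of
`t` and `t + 1` parts. -/
def TriangleBoundAt (ι : Type*) [Fintype ι] (t : ℝ) : Prop :=
  ∀ (w : ι → ι → ℝ) (x : ι → ℝ), IsWeight w → (∀ i, 0 ≤ x i) → ∑ i, x i = 1 →
    t - 1 ≤ t * edgeSum w x → (t + 1) * edgeSum w x ≤ t → triBound t (edgeSum w x) ≤ triSum w x

lemma TriangleBoundAt.exists_parts {ι : Type*} [Fintype ι] {t : ℝ} (ht : 1 ≤ t)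
    (hP : TriangleBoundAt ι t) {w : ι → ι → ℝ} {x : ι → ℝ} (hw : IsWeight w)
    (hx : ∀ i, 0 ≤ x i) (hd : 0 < ∑ i, x i) (h₀ : (t - 1) * (∑ i, x i) ^ 2 ≤ t * edgeSum w x)
    (h₁ : (t + 1) * edgeSum w x ≤ t * (∑ i, x i) ^ 2) :
    ∃ α β : ℝ, 0 ≤ β ∧ β ≤ α ∧ t * α + β = ∑ i, x i ∧
      edgeSum w x = t * (t - 1) * α ^ 2 + 2 * t * α * β ∧
      t * (t - 1) * α ^ 2 * ((t - 2) * α + 3 * β) ≤ triSum w x := by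
  set d := ∑ i, x i with hdd
  have ht0 : 0 < t := by linarith
  have hE : edgeSum w (fun i => d⁻¹ * x i) = d⁻¹ ^ 2 * edgeSum w x := edgeSum_smul _
  have hK : triSum w (fun i => d⁻¹ * x i) = d⁻¹ ^ 3 * triSum w x := triSum_smul _
  set e := edgeSum w (fun i => d⁻¹ * x i) with he
  have hEe : edgeSum w x = d ^ 2 * e := by rw [hE]; field_simp
  rw [hEe] at h₀ h₁
  have h₀' : t - 1 ≤ t * e := le_of_mul_le_mul_left (a := d ^ 2) (by linarith) (by positivity)
  have h₁' : (t + 1) * e ≤ t := le_of_mul_le_mul_left (a := d ^ 2) (by linarith) (by positivity)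
  have hb := hP w (fun i => d⁻¹ * x i) hw (fun i => mul_nonneg (inv_nonneg.2 hd.le) (hx i))
    (by rw [← mul_sum, ← hdd, inv_mul_cancel₀ hd.ne']) h₀' h₁'
  rw [← he, triBound_eq ht0 rfl rfl, hK] at hb
  have hE2 := edge_density_eq ht0 h₁' rfl rfl
  have hr := rootOf_nonneg t e
  have hr' := rootOf_le ht0 h₀'
  set a := (1 + rootOf t e) / (t + 1) with ha
  set b := (1 - t * rootOf t e) / (t + 1) with hb'
  refine ⟨d * a, d * b, mul_nonneg hd.le (div_nonneg (by linarith) (by linarith)), ?_, ?_, ?_, ?_⟩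
  · refine mul_le_mul_of_nonneg_left ?_ hd.le
    rw [ha, hb']
    gcongr
    nlinarith
  · rw [ha, hb']; field_simp; ring
  · rw [hEe, hE2]; ring
  · have h5 := mul_le_mul_of_nonneg_left hb (by positivity : 0 ≤ d ^ 3)
    have h6 : d ^ 3 * (d⁻¹ ^ 3 * triSum w x) = triSum w x := by field_simp
    rw [h6] at h5
    refine le_trans (le_of_eq ?_) h5
    ring

/-- Weighted graphs of total mass `1` whose edge density lies between the Turán densities of
`t` and `t + 1` parts. -/
def densityRange (ι : Type*) [Fintype ι] (t : ℝ) : Set ((ι → ℝ) × (ι → ι → ℝ)) :=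
  {p | IsWeight p.2 ∧ (∀ i, 0 ≤ p.1 i) ∧ ∑ i, p.1 i = 1 ∧
    t - 1 ≤ t * edgeSum p.2 p.1 ∧ (t + 1) * edgeSum p.2 p.1 ≤ t}

section Extremal

variable {ι : Type*} [Fintype ι]

lemma continuous_edgeSum :
    Continuous fun p : (ι → ℝ) × (ι → ι → ℝ) => edgeSum p.2 p.1 := by
  unfold edgeSum
  fun_prop

lemma continuous_triSum :
    Continuous fun p : (ι → ℝ) × (ι → ι → ℝ) => triSum p.2 p.1 := by
  unfold triSum
  fun_prop

lemma isCompact_densityRange (t : ℝ) : IsCompact (densityRange ι t) := by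
  have hcpt : IsCompact (Set.Icc (0 : ι → ℝ) 1 ×ˢ Set.Icc (0 : ι → ι → ℝ) 1) :=
    isCompact_Icc.prod isCompact_Icc
  refine hcpt.of_isClosed_subset ?_ ?_
  · have hset : densityRange ι t =
        ((⋂ i, ⋂ j, {p | p.2 i j = p.2 j i}) ∩ (⋂ i, ⋂ j, {p | 0 ≤ p.2 i j})
          ∩ ⋂ i, ⋂ j, {p | p.2 i j ≤ 1}) ∩ ((⋂ i, {p | 0 ≤ p.1 i}) ∩ ({p | ∑ i, p.1 i = 1} ∩
          ({p | t - 1 ≤ t * edgeSum p.2 p.1} ∩ {p | (t + 1) * edgeSum p.2 p.1 ≤ t}))) := by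
      ext p
      simp only [densityRange, Set.mem_ofPred_eq, Set.mem_inter_iff, Set.mem_iInter]
      exact and_congr_left fun _ => ⟨fun h => ⟨⟨h.1, h.2⟩, h.3⟩, fun h => ⟨h.1.1, h.1.2, h.2⟩⟩
    have hE := continuous_edgeSum (ι := ι)
    rw [hset]
    refine (((isClosed_iInter fun i => isClosed_iInter fun j => isClosed_eq ?_ ?_).inter
      (isClosed_iInter fun i => isClosed_iInter fun j => isClosed_le ?_ ?_)).inter
      (isClosed_iInter fun i => isClosed_iInter fun j => isClosed_le ?_ ?_)).inter
      ((isClosed_iInter fun i => isClosed_le ?_ ?_).inter ((isClosed_eq ?_ ?_).inter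
      ((isClosed_le ?_ ?_).inter (isClosed_le ?_ ?_)))) <;> fun_prop
  · rintro ⟨x, w⟩ ⟨hw, hx, h1, -⟩
    refine ⟨⟨fun i => hx i, fun i => ?_⟩,
      ⟨fun i j => hw.nonneg i j, fun i j => hw.le_one i j⟩⟩
    rw [Pi.one_apply, ← h1]
    exact single_le_sum (fun i _ => hx i) (mem_univ i)

/-- First-order condition at a minimiser with edge density in the interior of the range. -/
lemma first_order_condition {t : ℝ} (ht : 0 < t) {w : ι → ι → ℝ} {x : ι → ℝ}
    (hmin : ∀ p ∈ densityRange ι t,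
      triSum w x - triBound t (edgeSum w x) ≤ triSum p.2 p.1 - triBound t (edgeSum p.2 p.1))
    (h₀ : t - 1 < t * edgeSum w x) (h₁ : (t + 1) * edgeSum w x < t)
    {W : ℝ → ι → ι → ℝ} {X : ℝ → ι → ℝ} (hW0 : W 0 = w) (hX0 : X 0 = x)
    (hW : ∀ η ∈ Set.Icc (0 : ℝ) (1 / 2), IsWeight (W η))
    (hX : ∀ η ∈ Set.Icc (0 : ℝ) (1 / 2), ∀ i, 0 ≤ X η i)
    (hX1 : ∀ η, ∑ i, X η i = 1) {E' K' : ℝ}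
    (hE : HasDerivAt (fun η => edgeSum (W η) (X η)) E' 0)
    (hK : HasDerivAt (fun η => triSum (W η) (X η)) K' 0) :
    3 * ((t - 1) * ((1 + rootOf t (edgeSum w x)) / (t + 1))) * E' ≤ K' := by
  have hg : HasDerivAt (triBound t) (3 * ((t - 1) * ((1 + rootOf t (edgeSum w x)) / (t + 1))))
      (edgeSum (W 0) (X 0)) := by
    rw [hW0, hX0]
    exact hasDerivAt_triBound ht h₁
  have hφ := hK.fun_sub (hg.comp (0 : ℝ) hE)
  rw [← sub_nonneg]
  refine deriv_nonneg_of_right_min hφ ?_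
  have hlim : Tendsto (fun η => edgeSum (W η) (X η)) (𝓝[>] 0) (𝓝 (edgeSum w x)) := by
    have := hE.continuousAt.tendsto
    rw [hW0, hX0] at this
    exact this.mono_left nhdsWithin_le_nhds
  have e1 := (hlim.const_mul t).eventually (lt_mem_nhds h₀)
  have e2 := (hlim.const_mul (t + 1)).eventually (gt_mem_nhds h₁)
  have e3 : ∀ᶠ η in 𝓝[>] (0 : ℝ), η ∈ Set.Ioc (0 : ℝ) (1 / 2) :=
    Ioc_mem_nhdsGT (by norm_num)
  filter_upwards [e1, e2, e3] with η he1 he2 he3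
  have he3' : η ∈ Set.Icc (0 : ℝ) (1 / 2) := ⟨he3.1.le, he3.2⟩
  have := hmin (X η, W η) ⟨hW η he3', hX η he3', hX1 η, he1.le, he2.le⟩
  simpa [hW0, hX0] using this

variable {t : ℝ} {w : ι → ι → ℝ} {x : ι → ℝ}

lemma weight_condition (ht : 0 < t) (hw : IsWeight w) (hx : ∀ i, 0 ≤ x i) (hx1 : ∑ i, x i = 1)
    (hmin : ∀ p ∈ densityRange ι t,
      triSum w x - triBound t (edgeSum w x) ≤ triSum p.2 p.1 - triBound t (edgeSum p.2 p.1))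
    (h₀ : t - 1 < t * edgeSum w x) (h₁ : (t + 1) * edgeSum w x < t)
    {N : ι → ι → ℝ} (hNs : ∀ i j, N i j = N j i) (hN0 : ∀ i j, 0 ≤ N i j)
    (hN2 : ∀ i j, N i j ≤ 2) :
    ∑ i, ∑ j, w i j * N i j * codeg w x i j * x i * x j ≤
      (t - 1) * ((1 + rootOf t (edgeSum w x)) / (t + 1)) * ∑ i, ∑ j, w i j * N i j * x i * x j := by
  have h := first_order_condition ht hmin h₀ h₁
    (W := fun η i j => w i j + η * (-(w i j * N i j))) (X := fun _ => x)
    (by simp) rfl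
    (by
      rintro η ⟨hη0, hη1⟩
      have h1 : ∀ i j, 0 ≤ η * N i j := fun i j => mul_nonneg hη0 (hN0 i j)
      have h2 : ∀ i j, η * N i j ≤ 1 := fun i j => by nlinarith [hN0 i j, hN2 i j]
      refine ⟨fun i j => by rw [hw.symm i j, hNs i j], fun i j => ?_, fun i j => ?_⟩
      · nlinarith [mul_nonneg (hw.nonneg i j) (sub_nonneg.2 (h2 i j))]
      · nlinarith [mul_nonneg (hw.nonneg i j) (h1 i j), hw.le_one i j])
    (fun _ _ => hx) (fun _ => hx1) (hasDerivAt_edgeSum_weight _) (hasDerivAt_triSum_weight hw _)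
  simp only [neg_mul, sum_neg_distrib] at h
  linarith

lemma vertex_condition [DecidableEq ι] (ht : 0 < t) (hw : IsWeight w) (hx : ∀ i, 0 ≤ x i)
    (hx1 : ∑ i, x i = 1)
    (hmin : ∀ p ∈ densityRange ι t,
      triSum w x - triBound t (edgeSum w x) ≤ triSum p.2 p.1 - triBound t (edgeSum p.2 p.1))
    (h₀ : t - 1 < t * edgeSum w x) (h₁ : (t + 1) * edgeSum w x < t) {v : ι} (hv : 0 < x v) :
    edgeSum w (link w x v) =
      2 * ((t - 1) * ((1 + rootOf t (edgeSum w x)) / (t + 1))) * wdeg w x v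
      - (2 * ((t - 1) * ((1 + rootOf t (edgeSum w x)) / (t + 1))) * edgeSum w x
        - triSum w x) := by
  set κ := (t - 1) * ((1 + rootOf t (edgeSum w x)) / (t + 1))
  have hv1 : x v ≤ 1 := by
    rw [← hx1]; exact single_le_sum (fun i _ => hx i) (mem_univ v)
  have key : ∀ σ : ℝ, |σ| ≤ 1 → 0 ≤ σ * (x v * (edgeSum w (link w x v) - triSum w x -
      2 * κ * (wdeg w x v - edgeSum w x))) := by
    intro σ hσ
    rw [abs_le] at hσ
    have hsum : ∀ f : ι → ℝ, ∑ i, σ * x v * ((if i = v then 1 else 0) - x i) * f i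
        = σ * x v * (f v - ∑ i, x i * f i) := by
      intro f
      simp only [mul_assoc, sub_mul, ite_mul, one_mul, zero_mul, ← mul_sum, sum_sub_distrib,
        sum_ite_eq', mem_univ, if_true]
    have h := first_order_condition ht hmin h₀ h₁ (W := fun _ => w)
      (X := fun η i => x i + η * (σ * x v * ((if i = v then 1 else 0) - x i))) rfl (by simp)
      (fun _ _ => hw)
      (by
        rintro η ⟨hη0, hη1⟩ i
        have h1 : |η * σ| ≤ 1 := by rw [abs_le]; constructor <;> nlinarith
        rw [abs_le] at h1
        have h2 : -1 ≤ η * σ * x v ∧ η * σ * x v ≤ 1 := by constructor <;> nlinarith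
        split_ifs with hi
        · subst hi
          have : 0 ≤ x i * (1 + η * σ * (1 - x i)) := mul_nonneg hv.le (by nlinarith)
          linarith
        · have : 0 ≤ x i * (1 - η * σ * x v) := mul_nonneg (hx i) (by linarith)
          linarith)
      (fun η => by
        have := hsum fun _ => 1
        simp only [mul_one, hx1, sub_self, mul_zero] at this
        rw [sum_add_distrib, ← mul_sum, this, hx1, mul_zero, add_zero])
      (hasDerivAt_edgeSum_vertex hw _) (hasDerivAt_triSum_vertex hw _)
    rw [hsum, hsum, sum_mul_wdeg, sum_mul_edgeSum_link] at h
    linarith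
  have k1 := key 1 (by simp)
  have k2 := key (-1) (by simp)
  have k3 : x v * (edgeSum w (link w x v) - triSum w x - 2 * κ * (wdeg w x v - edgeSum w x)) = 0 :=
    by linarith
  have := (mul_eq_zero.1 k3).resolve_left hv.ne'
  linarith

lemma link_edge_condition [DecidableEq ι] (ht : 0 < t) (hw : IsWeight w) (hx : ∀ i, 0 ≤ x i)
    (hx1 : ∑ i, x i = 1)
    (hmin : ∀ p ∈ densityRange ι t,
      triSum w x - triBound t (edgeSum w x) ≤ triSum p.2 p.1 - triBound t (edgeSum p.2 p.1))
    (h₀ : t - 1 < t * edgeSum w x) (h₁ : (t + 1) * edgeSum w x < t) {v : ι} (hv : 0 < x v) :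
    edgeSum w (link w x v) ≤
      (t - 1) * ((1 + rootOf t (edgeSum w x)) / (t + 1)) * wdeg w x v := by
  have h := weight_condition ht hw hx hx1 hmin h₀ h₁
    (N := fun i j => (if i = v then 1 else 0) + if j = v then 1 else 0)
    (fun i j => add_comm _ _) (fun i j => by split_ifs <;> norm_num)
    (fun i j => by split_ifs <;> norm_num)
  have e : ∀ f : ι → ι → ℝ, (∀ i j, f i j = f j i) →
      ∑ i, ∑ j, w i j * ((if i = v then 1 else 0) + if j = v then 1 else 0) * f i j
        = 2 * ∑ j, w v j * f v j := by
    intro f hf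
    simp only [mul_add, add_mul, sum_add_distrib, mul_ite, mul_one, mul_zero, ite_mul, zero_mul,
      sum_ite_eq', mem_univ, if_true]
    rw [sum_comm]
    simp only [sum_ite_eq', mem_univ, if_true, two_mul]
    congr 1
    exact sum_congr rfl fun i _ => by rw [hw.symm i v, hf i v]
  have e1 := e (fun i j => codeg w x i j * x i * x j) fun i j => by
    have : codeg w x j i = codeg w x i j := sum_congr rfl fun k _ => by ring
    rw [this]; ring
  have e2 := e (fun i j => x i * x j) fun i j => mul_comm _ _
  simp only [← mul_assoc] at e1 e2
  rw [e1, e2] at h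
  have e3 : ∑ j, w v j * codeg w x v j * x v * x j = x v * edgeSum w (link w x v) := by
    rw [edgeSum_link_eq, mul_sum]
    exact sum_congr rfl fun j _ => by ring
  have e4 : ∑ j, w v j * x v * x j = x v * wdeg w x v := by
    rw [wdeg, mul_sum]
    exact sum_congr rfl fun j _ => by ring
  rw [e3, e4] at h
  refine le_of_mul_le_mul_left ?_ hv
  linarith

lemma wdeg_le_one (hw : IsWeight w) (hx : ∀ i, 0 ≤ x i) (hx1 : ∑ i, x i = 1) (v : ι) :
    wdeg w x v ≤ 1 := by
  rw [← hx1]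
  exact sum_le_sum fun j _ => mul_le_of_le_one_left (hx j) (hw.le_one v j)

/-- Lower bound for the triangles in the link of a vertex, `a` being the size of the large parts. -/
lemma link_triSum_lower_bound {A : ℝ} (hA : 2 ≤ A) (hP : TriangleBoundAt ι A) (hw : IsWeight w)
    {y : ι → ℝ} (hy : ∀ i, 0 ≤ y i) {a : ℝ} (ha : 0 < a)
    (hd : ∑ i, y i ≤ (A + 2) * a) (h₁ : edgeSum w y ≤ A * a * ∑ i, y i)
    (h₂ : edgeSum w y ≤ 2 * A * a * (∑ i, y i) - A * (A + 1) * a ^ 2) :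
    3 * A * a * edgeSum w y - 3 * A * (A + 1) * a ^ 2 * (∑ i, y i)
      + A * (A + 1) * (A + 2) * a ^ 3 ≤ triSum w y := by
  have hE0 := edgeSum_nonneg hw hy
  obtain ⟨z, rfl⟩ : ∃ z : ι → ℝ, y = fun i => a * z i := ⟨fun i => a⁻¹ * y i, by
    ext i; field_simp⟩
  have hz : ∀ i, 0 ≤ z i := fun i => nonneg_of_mul_nonneg_right (hy i) ha
  rw [edgeSum_smul] at *
  rw [triSum_smul]
  simp only [← mul_sum] at *
  have ha2 : 0 < a ^ 2 := by positivity
  set d := ∑ i, z i with hdd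
  have hE0 := edgeSum_nonneg hw hz
  have hK := goodman hw hz
  rw [← hdd] at hK
  have h₁' : edgeSum w z ≤ A * d := le_of_mul_le_mul_left (a := a ^ 2) (by linarith) ha2
  have h₂' : edgeSum w z ≤ 2 * A * d - A * (A + 1) :=
    le_of_mul_le_mul_left (a := a ^ 2) (by linarith) ha2
  have hd' : d ≤ A + 2 := le_of_mul_le_mul_left (a := a) (by linarith) ha
  have hd0 : 0 < d := by
    by_contra! h
    nlinarith
  suffices h : 3 * A * edgeSum w z - 3 * A * (A + 1) * d + A * (A + 1) * (A + 2) ≤ triSum w z by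
    have := mul_le_mul_of_nonneg_left h (by positivity : 0 ≤ a ^ 3)
    linarith
  rcases le_total (A * edgeSum w z) ((A - 1) * d ^ 2) with h | h
  · exact cubic_bound_of_goodman hA hd0 hd' h hK h₁' h₂'
  · obtain ⟨α, β, h3, h4, h5, h6, h7⟩ := hP.exists_parts (by linarith) hw hz hd0 h (by
      nlinarith [mul_nonneg (by linarith : 0 ≤ A) (sq_nonneg (d - (A + 1)))])
    exact cubic_bound_of_turan_piece hA h3 h4 h5 h6 h7 h₁' h₂'

lemma triBound_left {t : ℝ} (ht : 0 < t) {e : ℝ} (he : t * e = t - 1) :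
    triBound t e = 2 * e ^ 2 - e := by
  obtain rfl : e = (t - 1) / t := by field_simp; linarith
  have hr : rootOf t ((t - 1) / t) = 1 / t := by
    rw [rootOf, show 1 - (t + 1) * ((t - 1) / t) / t = (1 / t) ^ 2 by field_simp; ring]
    exact Real.sqrt_sq (by positivity)
  rw [triBound, hr]
  field_simp
  ring

lemma triBound_right {t : ℝ} (ht : 0 < t) {e : ℝ} (he : (t + 1) * e = t) :
    triBound t e = 2 * e ^ 2 - e := by
  obtain rfl : e = t / (t + 1) := by field_simp; linarith
  have hr : rootOf t (t / (t + 1)) = 0 := by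
    rw [rootOf, show 1 - (t + 1) * (t / (t + 1)) / t = 0 by field_simp; ring, Real.sqrt_zero]
  rw [triBound, hr]
  field_simp
  ring

lemma triangleBoundAt_step {A : ℝ} (hA : A = 1 ∨ 2 ≤ A ∧ TriangleBoundAt ι A) :
    TriangleBoundAt ι (A + 1) := by
  classical
  by_contra hcon
  have hA1 : 1 ≤ A := by rcases hA with h | h <;> linarith
  obtain ⟨t, htA⟩ : ∃ t, t = A + 1 := ⟨_, rfl⟩
  rw [← htA] at hcon
  have ht : 0 < t := by linarith
  simp only [TriangleBoundAt, not_forall, not_le, exists_prop] at hcon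
  obtain ⟨w₀, x₀, hw₀, hx₀, hx₀1, hl₀, hu₀, hlt₀⟩ := hcon
  obtain ⟨⟨x, w⟩, ⟨hw, hx, hx1, hl, hu⟩, hmin⟩ := (isCompact_densityRange (ι := ι) t).exists_isMinOn
    ⟨(x₀, w₀), hw₀, hx₀, hx₀1, hl₀, hu₀⟩
    (f := fun p => triSum p.2 p.1 - triBound t (edgeSum p.2 p.1))
    (continuous_triSum.sub ((continuous_triBound t).comp continuous_edgeSum)).continuousOn
  simp only [isMinOn_iff] at hmin
  dsimp only at hw hx hx1 hl hu hmin
  have hneg : triSum w x < triBound t (edgeSum w x) := by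
    have := hmin (x₀, w₀) ⟨hw₀, hx₀, hx₀1, hl₀, hu₀⟩
    dsimp only at this
    linarith
  have hgood := goodman hw hx
  rw [hx1] at hgood
  have h₀ : t - 1 < t * edgeSum w x := by
    refine hl.lt_of_ne fun h => ?_
    rw [triBound_left ht h.symm] at hneg
    linarith
  have h₁ : (t + 1) * edgeSum w x < t := by
    refine hu.lt_of_ne fun h => ?_
    rw [triBound_right ht h] at hneg
    linarith
  have hN := weight_condition ht hw hx hx1 hmin h₀ h₁
    (N := fun i j => ∑ k, (1 - w i k) * (1 - w j k) * x k)
    (fun i j => sum_congr rfl fun k _ => by ring)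
    (fun i j => sum_nonneg fun k _ => mul_nonneg (mul_nonneg (sub_nonneg.2 (hw.le_one i k))
      (sub_nonneg.2 (hw.le_one j k))) (hx k))
    (fun i j => by
      refine (sum_le_sum (g := x) fun k _ => mul_le_of_le_one_left (hx k) ?_).trans (by linarith)
      exact mul_le_one₀ (by linarith [hw.nonneg i k]) (sub_nonneg.2 (hw.le_one j k))
        (by linarith [hw.nonneg j k]))
  have hV := fun v hv => vertex_condition ht hw hx hx1 hmin h₀ h₁ (v := v) hv
  have hL := fun v hv => link_edge_condition ht hw hx hx1 hmin h₀ h₁ (v := v) hv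
  have hr := rootOf_nonneg t (edgeSum w x)
  have hr1 := rootOf_le ht h₀.le
  have hbound := triBound_eq ht (e := edgeSum w x) rfl rfl
  have hdens := edge_density_eq ht hu rfl rfl
  set a := (1 + rootOf t (edgeSum w x)) / (t + 1) with ha
  obtain ⟨b, hb⟩ : ∃ b, b = (1 - t * rootOf t (edgeSum w x)) / (t + 1) := ⟨_, rfl⟩
  rw [← hb] at hbound hdens
  have hab : t * a + b = 1 := by rw [ha, hb]; field_simp; ring
  have ha0 : 0 < a := by positivity
  have hba : b ≤ a := by
    rw [ha, hb]
    gcongr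
    nlinarith
  have hup := k4_upper_bound hw hx hx1 hN hV
  clear_value a
  set E := edgeSum w x
  set K := triSum w x
  set B := triBound t E
  obtain rfl : A = t - 1 := by linarith
  obtain rfl : b = 1 - t * a := by linarith
  have hγ : 2 * ((t - 1) * a) * E - B = t * (t - 1) * a ^ 2 := by
    rw [hbound, hdens]; ring
  have hrhs : 3 * ((t - 1) * a) * (E + K) - 2 * K + 3 * E * K - 6 * ((t - 1) * a) * E ^ 2 =
      3 * (t - 1) * a * K - 3 * (t - 1) * t * a ^ 2 * E + (t - 1) * t * (t + 1) * a ^ 3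
        - (3 * E - 2) * (B - K) := by
    rw [hbound, hdens]; ring
  rcases hA with hA | ⟨hA, hP⟩
  · obtain rfl : t = 2 := by linarith
    have hK4 : 0 ≤ ∑ v, x v * triSum w (link w x v) :=
      sum_nonneg fun v _ => mul_nonneg (hx v) (triSum_nonneg hw (link_nonneg hw hx v))
    have : 0 < (B - K) * (3 * a + 3 * E - 2) := mul_pos (by linarith) (by linarith)
    linarith [mul_nonneg ha0.le ha0.le, congr_arg (fun z => 3 * a * z) hγ]
  · have hlow : ∀ v, x v * (3 * (t - 1) * a * edgeSum w (link w x v)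
        - 3 * (t - 1) * t * a ^ 2 * wdeg w x v + (t - 1) * t * (t + 1) * a ^ 3)
        ≤ x v * triSum w (link w x v) := by
      intro v
      rcases (hx v).eq_or_lt with h | h
      · simp [← h]
      refine mul_le_mul_of_nonneg_left ?_ h.le
      have := link_triSum_lower_bound hA hP hw (link_nonneg hw hx v) ha0
        (by rw [sum_link]; have := wdeg_le_one hw hx hx1 v; linarith)
        (by rw [sum_link]; exact hL v h) (by rw [sum_link, hV v h]; linarith)
      rw [sum_link] at this
      linarith
    have hsum := sum_le_sum fun v (_ : v ∈ univ) => hlow v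
    have hsum' : ∑ v, x v * (3 * (t - 1) * a * edgeSum w (link w x v)
        - 3 * (t - 1) * t * a ^ 2 * wdeg w x v + (t - 1) * t * (t + 1) * a ^ 3)
        = 3 * (t - 1) * a * K - 3 * (t - 1) * t * a ^ 2 * E + (t - 1) * t * (t + 1) * a ^ 3 := by
      have s1 : K = ∑ v, x v * edgeSum w (link w x v) := sum_mul_edgeSum_link.symm
      have s2 : E = ∑ v, x v * wdeg w x v := sum_mul_wdeg.symm
      have s3 : (t - 1) * t * (t + 1) * a ^ 3 = ∑ v, x v * ((t - 1) * t * (t + 1) * a ^ 3) := by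
        rw [← sum_mul, hx1, one_mul]
      rw [s1, s2]
      nth_rewrite 2 [s3]
      simp only [mul_sum, ← sum_sub_distrib, ← sum_add_distrib]
      exact sum_congr rfl fun v _ => by ring
    have hE : 2 < 3 * E := by nlinarith
    have : 0 < (3 * E - 2) * (B - K) := mul_pos (by linarith) (by linarith)
    linarith

theorem triangleBoundAt_nat (t : ℕ) (ht : 1 ≤ t) : TriangleBoundAt ι t := by
  induction t, ht using Nat.le_induction with
  | base =>
    intro w x hw hx _ _ _
    simpa [triBound] using triSum_nonneg hw hx
  | succ n hn ih =>
    rw [Nat.cast_succ]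
    refine triangleBoundAt_step ?_
    rcases hn.eq_or_lt with h | h
    · exact Or.inl (by simp [← h])
    · exact Or.inr ⟨by exact_mod_cast h, ih⟩

end Extremal

section Graph

open Classical in
/-- The uniformly weighted graph attached to a simple graph. -/
noncomputable def adjWeight {V : Type*} (G : SimpleGraph V) (i j : V) : ℝ :=
  if G.Adj i j then 1 else 0

variable {V : Type*}

lemma isWeight_adjWeight (G : SimpleGraph V) : IsWeight (adjWeight G) where
  symm i j := by classical exact if_congr (G.adj_comm i j) rfl rfl
  nonneg i j := by unfold adjWeight; split_ifs <;> norm_num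
  le_one i j := by unfold adjWeight; split_ifs <;> norm_num

variable [Fintype V]

lemma edgeSum_adjWeight (G : SimpleGraph V) :
    edgeSum (adjWeight G) (fun _ => 1) = 2 * (G.edgeSet.ncard : ℝ) := by
  classical
  have h1 := G.sum_degrees_eq_twice_card_edges
  have h2 : G.edgeSet.ncard = #G.edgeFinset := by
    rw [← SimpleGraph.coe_edgeFinset, Set.ncard_coe_finset]
  rw [h2]
  have h3 : ((∑ v, G.degree v : ℕ) : ℝ) = 2 * (#G.edgeFinset : ℝ) := by
    rw [h1]; push_cast; rfl
  rw [← h3]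
  push_cast
  refine sum_congr rfl fun i _ => ?_
  simp only [adjWeight, mul_one, sum_boole, ← SimpleGraph.card_neighborFinset_eq_degree,
    SimpleGraph.neighborFinset_eq_filter]

lemma triSum_adjWeight_le (G : SimpleGraph V) :
    triSum (adjWeight G) (fun _ => 1) ≤ 6 * (kcliques G 3 : ℝ) := by
  classical
  have hk : kcliques G 3 = #(G.cliqueFinset 3) := by
    rw [kcliques, ← Set.ncard_coe_finset]
    congr 1
    ext s
    simp
  set S : Finset (V × V × V) :=
    {p | G.Adj p.1 p.2.1 ∧ G.Adj p.1 p.2.2 ∧ G.Adj p.2.1 p.2.2} with hS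
  have h1 : triSum (adjWeight G) (fun _ => 1) = #S := by
    rw [hS, ← sum_boole, Fintype.sum_prod_type]
    refine sum_congr rfl fun i _ => ?_
    rw [Fintype.sum_prod_type]
    refine sum_congr rfl fun j _ => sum_congr rfl fun k _ => ?_
    simp only [adjWeight, mul_one, ite_and]
    split_ifs <;> simp
  have h2 : #S ≤ 6 * #(G.cliqueFinset 3) := by
    refine card_le_mul_card_image_of_maps_to (f := fun p => {p.1, p.2.1, p.2.2}) ?_ 6 ?_
    · rintro ⟨i, j, k⟩ hp
      simp only [hS, mem_filter, mem_univ, true_and] at hp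
      simp only [SimpleGraph.mem_cliqueFinset_iff]
      exact SimpleGraph.is3Clique_triple_iff.2 hp
    · intro s hs
      rw [SimpleGraph.mem_cliqueFinset_iff, SimpleGraph.is3Clique_iff] at hs
      obtain ⟨a, b, c, -, -, -, rfl⟩ := hs
      have hsub : S.filter (fun p => ({p.1, p.2.1, p.2.2} : Finset V) = {a, b, c}) ⊆
          {(a, b, c), (a, c, b), (b, a, c), (b, c, a), (c, a, b), (c, b, a)} := by
        rintro ⟨i, j, k⟩ hp
        simp only [hS, mem_filter, mem_univ, true_and] at hp
        obtain ⟨⟨hij, hik, hjk⟩, he⟩ := hp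
        have hi : i ∈ ({a, b, c} : Finset V) := he ▸ by simp
        have hj : j ∈ ({a, b, c} : Finset V) := he ▸ by simp
        have hk : k ∈ ({a, b, c} : Finset V) := he ▸ by simp
        have := hij.ne
        have := hik.ne
        have := hjk.ne
        simp only [mem_insert, mem_singleton, Prod.mk.injEq] at hi hj hk ⊢
        grind
      exact (card_le_card hsub).trans card_le_six
  rw [h1, hk]
  exact_mod_cast h2

end Graph

theorem triangles_lower_bound (n m : ℕ) (hn : 3 ≤ n) (hm1 : 1 ≤ m) (hm2 : m ≤ n.choose 2)
    (G : SimpleGraph (Fin n)) (hG : G.edgeSet.ncard = m) :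
    (kcliques G 3 : ℝ) ≥
      ((sOf n m).choose 3 : ℝ) * (1 / (sOf n m : ℝ) ^ 3) *
        ((n : ℝ) - 2 * Real.sqrt ((n : ℝ) ^ 2 - 2 * (sOf n m : ℝ) * (m : ℝ) / ((sOf n m : ℝ) - 1))) *
        ((n : ℝ) + Real.sqrt ((n : ℝ) ^ 2 - 2 * (sOf n m : ℝ) * (m : ℝ) / ((sOf n m : ℝ) - 1))) ^ 2 := by
  have hn0 : (0 : ℝ) < n := by exact_mod_cast (by omega : 0 < n)
  have hm0 : (1 : ℝ) ≤ m := by exact_mod_cast hm1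
  set e : ℝ := 2 * (m : ℝ) / (n : ℝ) ^ 2 with he
  have he0 : 0 < e := by positivity
  have he1 : e < 1 := by
    have h : (m : ℝ) ≤ n * (n - 1) / 2 := by
      rw [← Nat.cast_choose_two]; exact_mod_cast hm2
    rw [he, div_lt_one (by positivity)]
    nlinarith
  have hpos : 0 < 1 - e := by linarith
  have hs1 : 1 < sOf n m := by
    rw [sOf, Nat.lt_ceil, Nat.cast_one, lt_div_iff₀ hpos]
    linarith
  have hsu : 1 / (1 - e) ≤ (sOf n m : ℝ) := Nat.le_ceil _
  have hsl : (sOf n m : ℝ) - 1 < 1 / (1 - e) := by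
    have := Nat.ceil_lt_add_one (a := 1 / (1 - e)) (by positivity)
    rw [sOf]
    linarith
  obtain ⟨t, ht⟩ : ∃ t, sOf n m = t + 1 := ⟨sOf n m - 1, by omega⟩
  rw [ht] at hs1 hsu hsl ⊢
  have ht1 : 1 ≤ t := by omega
  have ht0 : (0 : ℝ) < t := by exact_mod_cast ht1
  push_cast at hsu hsl ⊢
  rw [div_le_iff₀ hpos] at hsu
  rw [lt_div_iff₀ hpos] at hsl
  simp only [add_sub_cancel_right] at hsl ⊢
  have hE : edgeSum (adjWeight G) (fun _ => (n : ℝ)⁻¹ * 1) = e := by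
    rw [edgeSum_smul (x := fun _ => (1 : ℝ)), edgeSum_adjWeight, hG, he]
    field_simp
  have hK := triSum_smul (w := adjWeight G) (x := fun _ => (1 : ℝ)) (n : ℝ)⁻¹
  have hmain := triangleBoundAt_nat (ι := Fin n) t ht1 (adjWeight G) (fun _ => (n : ℝ)⁻¹ * 1)
    (isWeight_adjWeight G) (fun _ => by positivity) (by simp [hn0.ne'])
    (by rw [hE]; linarith) (by rw [hE]; linarith)
  rw [hE, hK] at hmain
  have hroot : √((n : ℝ) ^ 2 - 2 * (t + 1) * m / t) = n * rootOf t e := by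
    rw [rootOf, ← Real.sqrt_sq hn0.le, ← Real.sqrt_mul (sq_nonneg _), Real.sqrt_sq hn0.le]
    congr 1
    rw [he]
    field_simp
  have hchoose3 : ∀ u : ℕ, (u.choose 3 : ℝ) = u * (u - 1) * (u - 2) / 6 := by
    intro u
    induction u with
    | zero => simp
    | succ u ih =>
      rw [Nat.choose_succ_succ' u 2, Nat.cast_add, Nat.cast_choose_two, ih]
      push_cast
      ring
  have hchoose : ((t + 1).choose 3 : ℝ) = (t + 1) * t * (t - 1) / 6 := by
    rw [hchoose3]
    push_cast
    ring
  rw [hroot, hchoose]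
  have h6 := triSum_adjWeight_le G
  have h7 : (n : ℝ) ^ 3 * triBound t e ≤ 6 * (kcliques G 3 : ℝ) := by
    refine le_trans ?_ h6
    have := mul_le_mul_of_nonneg_left hmain (by positivity : 0 ≤ (n : ℝ) ^ 3)
    rwa [← mul_assoc, ← mul_pow, mul_inv_cancel₀ hn0.ne', one_pow, one_mul] at this
  have h8 : (t + 1 : ℝ) * t * (t - 1) / 6 * (1 / (t + 1) ^ 3) * (n - 2 * (n * rootOf t e)) *
      (n + n * rootOf t e) ^ 2 = (n : ℝ) ^ 3 * triBound t e / 6 := by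
    rw [triBound]
    field_simp
  rw [ge_iff_le, h8]
  linarith
end

section
/- Let n ≥ 3 and m be integers with n²/4 ≤ m ≤ n²/3 and m ≤ C(n,2). Then every simple graph G with n vertices and m edges satisfies k_3(G) ≥ (9nm − 2n³ − 2(n² − 3m)^{3/2})/27. -/
section CliquePolynomial

open Finset
open scoped Classical

variable {V : Type*} (G : SimpleGraph V)

/-- The sum of `c |s|` over all cliques `s` of `G` contained in `U`. -/
noncomputable def cliqueSum (c : ℕ → ℝ) (U : Finset V) : ℝ :=
  ∑ s ∈ U.powerset.filter (fun s : Finset V => G.IsClique (s : Set V)), c s.card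

/-- The alternating clique polynomial of the subgraph induced on `U`. -/
noncomputable def cliquePoly (y : ℝ) (U : Finset V) : ℝ :=
  cliqueSum G (fun k => (-y) ^ k) U

/-- The part of the clique polynomial in degrees at least `j`, with the sign `(-1) ^ j`. -/
noncomputable def cliquePolyTail (y : ℝ) (j : ℕ) (U : Finset V) : ℝ :=
  cliqueSum G (fun k => if j ≤ k then (-1) ^ j * (-y) ^ k else 0) U

lemma cliqueSum_empty (c : ℕ → ℝ) : cliqueSum G c ∅ = c 0 := by
  simp [cliqueSum, Finset.filter_singleton]

lemma cliqueSum_insert (c : ℕ → ℝ) {v : V} {U : Finset V} (hv : v ∉ U) :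
    cliqueSum G c (insert v U) =
      cliqueSum G c U + cliqueSum G (fun k => c (k + 1)) {u ∈ U | G.Adj v u} := by
  have hfilter :
      U.powerset.filter (fun t : Finset V => G.IsClique ((insert v t : Finset V) : Set V)) =
        ({u ∈ U | G.Adj v u} : Finset V).powerset.filter
          (fun t : Finset V => G.IsClique (t : Set V)) := by
    ext t
    simp only [mem_filter, mem_powerset, subset_iff, coe_insert]
    constructor
    · rintro ⟨ht, hc⟩
      rw [SimpleGraph.isClique_insert] at hc
      refine ⟨fun x hx => ⟨ht hx, hc.2 x hx ?_⟩, hc.1⟩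
      rintro rfl
      exact hv (ht hx)
    · rintro ⟨ht, hc⟩
      refine ⟨fun x hx => (ht hx).1, ?_⟩
      rw [SimpleGraph.isClique_insert]
      exact ⟨hc, fun b hb _ => (ht hb).2⟩
  simp only [cliqueSum, sum_filter]
  rw [sum_powerset_insert hv]
  congr 1
  rw [← sum_filter, ← sum_filter, hfilter]
  refine sum_congr rfl fun t ht => ?_
  rw [card_insert_of_notMem]
  simp only [mem_filter, mem_powerset, subset_iff] at ht
  exact fun h => hv (ht.1 h).1

lemma cliquePoly_insert (y : ℝ) {v : V} {U : Finset V} (hv : v ∉ U) :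
    cliquePoly G y (insert v U) =
      cliquePoly G y U - y * cliquePoly G y {u ∈ U | G.Adj v u} := by
  rw [cliquePoly, cliqueSum_insert G _ hv, sub_eq_add_neg, cliquePoly, cliquePoly]
  congr 1
  rw [cliqueSum, cliqueSum, mul_sum, ← sum_neg_distrib]
  exact sum_congr rfl fun s _ => by ring

lemma cliquePolyTail_insert (y : ℝ) (j : ℕ) {v : V} {U : Finset V} (hv : v ∉ U) :
    cliquePolyTail G y (j + 1) (insert v U) =
      cliquePolyTail G y (j + 1) U + y * cliquePolyTail G y j {u ∈ U | G.Adj v u} := by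
  rw [cliquePolyTail, cliqueSum_insert G _ hv, cliquePolyTail, cliquePolyTail]
  congr 1
  rw [cliqueSum, cliqueSum, mul_sum]
  refine sum_congr rfl fun s _ => ?_
  simp only [add_le_add_iff_right]
  split_ifs <;> ring

lemma cliquePolyTail_nonneg {y : ℝ} (hy : 0 ≤ y) (h : ∀ U, 0 ≤ cliquePoly G y U) (j : ℕ)
    (U : Finset V) : 0 ≤ cliquePolyTail G y j U := by
  induction j generalizing U with
  | zero => simpa [cliquePolyTail, cliquePoly] using h U
  | succ j ih =>
    induction U using Finset.induction_on with
    | empty => simp [cliquePolyTail, cliqueSum_empty]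
    | insert v U hv ihU =>
      rw [cliquePolyTail_insert G y j hv]
      exact add_nonneg ihU (mul_nonneg hy (ih _))

lemma continuous_cliquePoly (U : Finset V) : Continuous fun y => cliquePoly G y U := by
  unfold cliquePoly cliqueSum
  fun_prop

lemma cliquePoly_zero (U : Finset V) : cliquePoly G 0 U = 1 := by
  induction U using Finset.induction_on with
  | empty => simp [cliquePoly, cliqueSum_empty]
  | insert v U hv ih => simp [cliquePoly_insert G 0 hv, ih]

lemma cliquePoly_antitone {y : ℝ} (hy : 0 ≤ y) (h : ∀ U, 0 ≤ cliquePoly G y U) :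
    Antitone (cliquePoly G y) := by
  have hunion (S T : Finset V) : cliquePoly G y (S ∪ T) ≤ cliquePoly G y S := by
    induction T using Finset.induction_on with
    | empty => simp
    | insert v T _ ih =>
      rw [union_insert]
      by_cases hv : v ∈ S ∪ T
      · rwa [insert_eq_of_mem hv]
      · rw [cliquePoly_insert G y hv]
        linarith [mul_nonneg hy (h {u ∈ S ∪ T | G.Adj v u})]
  intro S U hSU
  simpa [union_eq_right.mpr hSU] using hunion S U

lemma cliquePoly_union_add_le [Fintype V] {y : ℝ} (hy : 0 ≤ y)
    (h : ∀ U, 0 ≤ cliquePoly G y U) {S T : Finset V} (hST : Disjoint S T) :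
    cliquePoly G y (S ∪ T) + y * ∑ u ∈ T, cliquePoly G y {w | G.Adj u w} ≤
      cliquePoly G y S := by
  induction T using Finset.induction_on generalizing S with
  | empty => simp
  | insert v T hv ih =>
    rw [disjoint_insert_right] at hST
    have hvST : v ∉ S ∪ T := by simp [hv, hST.1]
    rw [union_insert, cliquePoly_insert G y hvST, sum_insert hv, mul_add]
    have hanti : cliquePoly G y {w | G.Adj v w} ≤ cliquePoly G y {u ∈ S ∪ T | G.Adj v u} :=
      cliquePoly_antitone G hy h (filter_subset_filter _ (subset_univ _))
    linarith [ih hST.2, mul_le_mul_of_nonneg_left hanti hy]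

lemma cliqueSum_truncated_pow_univ [Fintype V] (a : ℝ) (N : ℕ) :
    cliqueSum G (fun k => if k < N then a ^ k else 0) univ =
      ∑ k ∈ range N, a ^ k * kcliques G k := by
  have hk (k : ℕ) : (kcliques G k : ℝ) =
      ∑ s : Finset V, if G.IsClique (s : Set V) ∧ #s = k then 1 else 0 := by
    rw [kcliques, Set.ncard_eq_toFinset_card', sum_boole]
    congr 2
    ext s
    simp [SimpleGraph.isNClique_iff]
  simp only [hk, mul_sum]
  rw [sum_comm, cliqueSum, powerset_univ, sum_filter]
  refine sum_congr rfl fun s _ => ?_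
  by_cases hs : G.IsClique (s : Set V)
  · simp [hs]
  · simp [hs]

lemma kcliques_two : kcliques G 2 = G.edgeSet.ncard := by
  symm
  refine Set.ncard_congr (fun (e : Sym2 V) _ => e.toFinset) ?_ ?_ ?_
  · rintro ⟨a, b⟩ h
    have hab : G.Adj a b := h
    have hfin : Sym2.toFinset s(a, b) = {a, b} := by ext x; simp
    change G.IsNClique 2 (Sym2.toFinset s(a, b))
    rw [hfin, SimpleGraph.isNClique_iff]
    exact ⟨by simpa using fun _ => hab, card_pair hab.ne⟩
  · intro a b _ _ hab
    ext x
    simpa using congrArg (x ∈ ·) hab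
  · intro s hs
    obtain ⟨hc, hs⟩ := (SimpleGraph.isNClique_iff _).mp hs
    obtain ⟨a, b, hab, rfl⟩ := card_eq_two.mp hs
    refine ⟨s(a, b), hc (by simp) (by simp) hab, ?_⟩
    ext x; simp

lemma mul_sum_compl_degree_le [Fintype V] {y : ℝ} (hy : 0 ≤ y)
    (h : ∀ U, 0 < cliquePoly G y U) :
    y * ∑ v, (#{u | ¬ G.Adj v u} : ℝ) ≤ Fintype.card V := by
  set d : V → ℝ := fun v => cliquePoly G y {w | G.Adj v w} with hd
  have hdpos (v : V) : 0 < d v := h _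
  have hrow (v : V) : y * ∑ u with ¬ G.Adj v u, d u / d v ≤ 1 := by
    have hdisj : Disjoint ({w | G.Adj v w} : Finset V) ({w | ¬ G.Adj v w} : Finset V) :=
      disjoint_filter_filter_not _ _ _
    have := cliquePoly_union_add_le G hy (fun U => (h U).le) hdisj
    rw [← sum_div, ← mul_div_assoc, div_le_one (hdpos v)]
    linarith [h (({w | G.Adj v w} : Finset V) ∪ ({w | ¬ G.Adj v w} : Finset V))]
  have hswap : ∑ v, ∑ u with ¬ G.Adj v u, d u / d v = ∑ v, ∑ u with ¬ G.Adj v u, d v / d u := by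
    simp only [sum_filter]
    rw [sum_comm]
    simp only [G.adj_comm]
  have hamgm : ∑ v, (#{u | ¬ G.Adj v u} : ℝ) ≤ ∑ v, ∑ u with ¬ G.Adj v u, d u / d v := by
    have : ∑ v, ∑ u with ¬ G.Adj v u, (2 : ℝ) ≤
        ∑ v, ∑ u with ¬ G.Adj v u, (d u / d v + d v / d u) := by
      refine sum_le_sum fun v _ => sum_le_sum fun u _ => ?_
      have hu := hdpos u
      have hv := hdpos v
      rw [div_add_div _ _ hv.ne' hu.ne', le_div_iff₀ (mul_pos hv hu)]
      nlinarith [sq_nonneg (d u - d v)]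
    simp only [sum_add_distrib, ← hswap, sum_const, nsmul_eq_mul, ← sum_mul] at this
    linarith
  calc _ ≤ y * ∑ v, ∑ u with ¬ G.Adj v u, d u / d v := by gcongr
    _ ≤ ∑ _v : V, (1 : ℝ) := by
      rw [mul_sum]
      exact sum_le_sum fun v _ => hrow v
    _ = _ := by simp

lemma sum_card_not_adj [Fintype V] :
    ∑ v, (#{u | ¬ G.Adj v u} : ℝ) = (Fintype.card V : ℝ) ^ 2 - 2 * G.edgeSet.ncard := by
  have hv (v : V) : (#{u | ¬ G.Adj v u} : ℝ) = Fintype.card V - G.degree v := by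
    have := card_filter_add_card_filter_not (s := (univ : Finset V)) (fun u => G.Adj v u)
    rw [← SimpleGraph.card_neighborFinset_eq_degree, SimpleGraph.neighborFinset_eq_filter,
      ← card_univ, ← this]
    push_cast
    ring
  have hedge : G.edgeSet.ncard = #G.edgeFinset := by
    rw [Set.ncard_eq_toFinset_card']
    rfl
  have hdeg : ∑ v, (G.degree v : ℝ) = 2 * G.edgeSet.ncard := by
    rw [hedge]
    exact_mod_cast G.sum_degrees_eq_twice_card_edges
  simp only [hv, sum_sub_distrib, hdeg]
  simp
  ring

/-- There is a point `y` at which the clique polynomial of `G` vanishes or is negative, while all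
clique polynomials of induced subgraphs are nonnegative. -/
lemma exists_cliquePoly_nonpos [Fintype V] [Nonempty V]
    (hG : 0 < (Fintype.card V : ℝ) ^ 2 - 2 * G.edgeSet.ncard) :
    ∃ y : ℝ, 0 < y ∧ y * ((Fintype.card V : ℝ) ^ 2 - 2 * G.edgeSet.ncard) ≤ Fintype.card V ∧
      (∀ U, 0 ≤ cliquePoly G y U) ∧ cliquePoly G y univ ≤ 0 := by
  set q : ℝ := (Fintype.card V : ℝ) ^ 2 - 2 * G.edgeSet.ncard with hq
  have hbound {y : ℝ} (hy : 0 ≤ y) (h : ∀ U, 0 < cliquePoly G y U) :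
      y * q ≤ Fintype.card V := by
    simpa only [sum_card_not_adj] using mul_sum_compl_degree_le G hy h
  set B : Set ℝ := {y | 0 ≤ y} ∩ ⋃ U : Finset V, {y | cliquePoly G y U ≤ 0} with hB
  have hclosed : IsClosed B := by
    refine (isClosed_le continuous_const continuous_id).inter (isClosed_iUnion_of_finite fun U => ?_)
    exact isClosed_le (continuous_cliquePoly G U) continuous_const
  have hbelow : BddBelow B := ⟨0, fun y hy => hy.1⟩
  have hnonempty : B.Nonempty := by
    refine ⟨(Fintype.card V + 1) / q, by simp only [Set.mem_ofPred_eq]; positivity, ?_⟩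
    by_contra hcon
    simp only [Set.mem_iUnion, Set.mem_ofPred_eq, not_exists, not_le] at hcon
    have := hbound (by positivity) hcon
    rw [div_mul_cancel₀ _ hG.ne'] at this
    linarith
  obtain ⟨hy0, hyU⟩ := hclosed.csInf_mem hnonempty hbelow
  set y := sInf B with hy
  have hlt {z : ℝ} (hz0 : 0 ≤ z) (hz : z < y) (U : Finset V) : 0 < cliquePoly G z U := by
    by_contra! hcon
    exact notMem_of_lt_csInf hz hbelow ⟨hz0, Set.mem_iUnion.mpr ⟨U, hcon⟩⟩
  obtain ⟨U, hU⟩ := Set.mem_iUnion.mp hyU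
  have hypos : 0 < y := by
    refine lt_of_le_of_ne hy0 fun h0 => ?_
    simp only [Set.mem_ofPred_eq, ← h0, cliquePoly_zero] at hU
    linarith
  have hmem : y ∈ closure (Set.Ioo 0 y) := by
    rw [closure_Ioo hypos.ne]
    exact Set.right_mem_Icc.mpr hypos.le
  have hnonneg (W : Finset V) : 0 ≤ cliquePoly G y W :=
    closure_minimal (fun z hz => (hlt hz.1.le hz.2 W).le)
      (isClosed_le continuous_const (continuous_cliquePoly G W)) hmem
  refine ⟨y, hypos, ?_, hnonneg, ?_⟩
  · have hsub : Set.Ioo 0 y ⊆ {z : ℝ | z * q ≤ Fintype.card V} :=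
      fun z hz => hbound hz.1.le (hlt hz.1.le hz.2)
    exact closure_minimal hsub (isClosed_le (by fun_prop) continuous_const) hmem
  · exact (cliquePoly_antitone G hypos.le hnonneg (subset_univ U)).trans hU

/-- The Bonferroni inequality truncating the clique polynomial after its cubic term. -/
lemma sum_range_four_le_cliquePoly [Fintype V] {y : ℝ} (hy : 0 ≤ y)
    (h : ∀ U, 0 ≤ cliquePoly G y U) :
    ∑ k ∈ range 4, (-y) ^ k * kcliques G k ≤ cliquePoly G y univ := by
  have htail := cliquePolyTail_nonneg G hy h 4 univ
  have hsplit : cliquePoly G y univ =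
      cliqueSum G (fun k => if k < 4 then (-y) ^ k else 0) univ + cliquePolyTail G y 4 univ := by
    simp only [cliquePoly, cliquePolyTail, cliqueSum, ← sum_add_distrib]
    refine sum_congr rfl fun s _ => ?_
    by_cases hs : #s < 4
    · simp [hs, not_le.mpr hs]
    · simp [hs, not_lt.mp hs, show (-1 : ℝ) ^ 4 = 1 by norm_num]
  rw [← cliqueSum_truncated_pow_univ]
  linarith

lemma kcliques_zero : kcliques G 0 = 1 := by
  rw [kcliques, Set.ncard_eq_one]
  exact ⟨∅, by ext s; simp [SimpleGraph.isNClique_iff]; rintro rfl; simp⟩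

lemma kcliques_one : kcliques G 1 = Nat.card V := by
  have : {t : Finset V | G.IsNClique 1 t} = Set.range fun v : V => ({v} : Finset V) := by
    ext t
    simp [eq_comm]
  rw [kcliques, this, ← Set.image_univ, Set.ncard_image_of_injective _ singleton_injective,
    Set.ncard_univ]

end CliquePolynomial

theorem triangles_lower_bound_fisher (n m : ℕ) (hn : 3 ≤ n)
    (hm1 : (n : ℝ) ^ 2 / 4 ≤ (m : ℝ)) (hm2 : (m : ℝ) ≤ (n : ℝ) ^ 2 / 3) (hm3 : m ≤ n.choose 2)
    (G : SimpleGraph (Fin n)) (hG : G.edgeSet.ncard = m) :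
    (kcliques G 3 : ℝ) ≥
      (9 * (n : ℝ) * (m : ℝ) - 2 * (n : ℝ) ^ 3 -
        2 * Real.sqrt ((n : ℝ) ^ 2 - 3 * (m : ℝ)) ^ 3) / 27 := by
  
  have hn0 : (0 : ℝ) < n := by positivity
  have : Nonempty (Fin n) := ⟨⟨0, by omega⟩⟩
  have hgap : (n : ℝ) ^ 2 / 3 ≤ (n : ℝ) ^ 2 - 2 * m := by linarith
  have hgap0 : (0 : ℝ) < n ^ 2 - 2 * m := lt_of_lt_of_le (by positivity) hgap
  obtain ⟨y, hy, hyle, hnonneg, hnonpos⟩ :=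
    exists_cliquePoly_nonpos G (by simpa [hG] using hgap0)
  have hbonf := (sum_range_four_le_cliquePoly G hy.le hnonneg).trans hnonpos
  simp only [Finset.sum_range_succ, Finset.sum_range_zero, kcliques_zero, kcliques_one,
    kcliques_two, hG, Nat.card_eq_fintype_card, Fintype.card_fin] at hbonf hyle
  obtain ⟨x, rfl⟩ : ∃ x : ℝ, y = x⁻¹ := ⟨y⁻¹, by simp⟩
  have hx : 0 < x := inv_pos.mp hy
  have hxn : (n : ℝ) / 3 ≤ x := by
    rw [inv_mul_le_iff₀ hx] at hyle
    nlinarith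
  have hcubic : x ^ 3 - n * x ^ 2 + m * x ≤ kcliques G 3 := by
    have := mul_le_mul_of_nonneg_left hbonf (pow_pos hx 3).le
    field_simp at this
    push_cast at this
    linarith
  set s := Real.sqrt ((n : ℝ) ^ 2 - 3 * m) with hs
  have hs0 : 0 ≤ s := Real.sqrt_nonneg _
  have hs2 : (m : ℝ) = (n ^ 2 - s ^ 2) / 3 := by
    rw [hs, Real.sq_sqrt (by linarith)]
    ring
  rw [hs2] at hcubic ⊢
  have hfactor : 0 ≤ (x - (n + s) / 3) ^ 2 * (x + 2 * ((n + s) / 3) - n) :=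
    mul_nonneg (sq_nonneg _) (by linarith)
  nlinarith
end
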